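/- The transcendental equation cos β · cosh β = 1 has positive solutions located as follows: there exists a solution β ∈ (3π/2, 2π), and for every integer k ≥ 1 there exist a solution β ∈ (2kπ, (2k + 1/2)π) and a solution β ∈ ((2k + 3/2)π, 2(k+1)π). -/

import Mathlib

open Real Set

theorem one_lt_cos_mul_cosh_natCast_mul_two_pi {n : ℕ} (hn : 1 ≤ n) :
    1 < Real.cos (n * (2 * π)) * Real.cosh (n * (2 * π)) := by
  rw [Real.cos_nat_mul_two_pi, one_mul, Real.one_lt_cosh]
  have : (0 : ℝ) < n := by exact_mod_cast hn
  positivity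

/-- The equation `cos β * cosh β = 1` has a solution in the quarter period following each
positive multiple of `2π`. -/
theorem exists_cos_mul_cosh_eq_one_right {n : ℕ} (hn : 1 ≤ n) :
    ∃ β ∈ Ioo (n * (2 * π)) (n * (2 * π) + π / 2), Real.cos β * Real.cosh β = 1 := by
  have hcos : Real.cos (n * (2 * π) + π / 2) = 0 := by
    rw [add_comm, Real.cos_add_nat_mul_two_pi, Real.cos_pi_div_two]
  refine intermediate_value_Ioo' (by linarith [Real.pi_pos])
    (f := fun x : ℝ => Real.cos x * Real.cosh x)
    (Real.continuous_cos.mul Real.continuous_cosh).continuousOn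
    ⟨?_, one_lt_cos_mul_cosh_natCast_mul_two_pi hn⟩
  simp [hcos]

/-- The equation `cos β * cosh β = 1` has a solution in the quarter period preceding each
positive multiple of `2π`. -/
theorem exists_cos_mul_cosh_eq_one_left {n : ℕ} (hn : 1 ≤ n) :
    ∃ β ∈ Ioo (n * (2 * π) - π / 2) (n * (2 * π)), Real.cos β * Real.cosh β = 1 := by
  have hcos : Real.cos (n * (2 * π) - π / 2) = 0 := by
    rw [Real.cos_nat_mul_two_pi_sub, Real.cos_pi_div_two]
  refine intermediate_value_Ioo (by linarith [Real.pi_pos])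
    (f := fun x : ℝ => Real.cos x * Real.cosh x)
    (Real.continuous_cos.mul Real.continuous_cosh).continuousOn
    ⟨?_, one_lt_cos_mul_cosh_natCast_mul_two_pi hn⟩
  simp [hcos]

/-- Location of the positive solutions of the transcendental equation
`cos β · cosh β = 1`: there is a solution in `(3π/2, 2π)`, and for every `k ≥ 1` there are
solutions in `(2kπ, (2k + 1/2)π)` and in `((2k + 3/2)π, 2(k+1)π)`. -/
theorem cos_cosh_eq_one_solutions :
    (∃ β ∈ Set.Ioo (3 * π / 2) (2 * π), Real.cos β * Real.cosh β = 1) ∧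
    ∀ k : ℕ, 1 ≤ k →
      (∃ β ∈ Set.Ioo (2 * (k : ℝ) * π) ((2 * (k : ℝ) + 1/2) * π),
        Real.cos β * Real.cosh β = 1) ∧
      (∃ β ∈ Set.Ioo ((2 * (k : ℝ) + 3/2) * π) (2 * ((k : ℝ) + 1) * π),
        Real.cos β * Real.cosh β = 1) := by
  refine ⟨?_, fun k hk => ⟨?_, ?_⟩⟩
  · convert exists_cos_mul_cosh_eq_one_left le_rfl using 5 <;> push_cast <;> ring
  · convert exists_cos_mul_cosh_eq_one_right hk using 5 <;> ring
  · convert exists_cos_mul_cosh_eq_one_left (Nat.le_add_left 1 k) using 5 <;> push_cast <;> ring
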